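/- arXiv:2602.21024 — 2 statements merged into one kernel-verified Lean document; each statement's English description precedes it below -/
import Mathlib

section
/- Let R be a commutative ring and n ≥ 1. For the matrix algebra A = M_n(R), the canonical R-algebra map A ⊗[R] A^op → End_R(A), sending a ⊗ b to the endomorphism x ↦ a x b, is an isomorphism. -/
open TensorProduct

/-- For `A = M_n(R)` with `n ≥ 1`, the canonical `R`-algebra map
`A ⊗[R] Aᵐᵒᵖ → End_R(A)`, `a ⊗ b ↦ (x ↦ a x b)`, is an isomorphism. -/
theorem matrix_tensor_op_to_end_bijective
    (R : Type*) [CommRing R] (n : ℕ) (hn : 1 ≤ n) :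
    ∃ f : (Matrix (Fin n) (Fin n) R ⊗[R] (Matrix (Fin n) (Fin n) R)ᵐᵒᵖ) →ₐ[R]
        Module.End R (Matrix (Fin n) (Fin n) R),
      (∀ (a b x : Matrix (Fin n) (Fin n) R),
        f (a ⊗ₜ[R] MulOpposite.op b) x = a * x * b) ∧ Function.Bijective f := by
  have : Nonempty (Fin n) := ⟨⟨0, hn⟩⟩
  exact ⟨AlgHom.mulLeftRight R _, fun a b x => by simp [AlgHom.mulLeftRight_apply],
    (IsAzumaya.matrix R (Fin n)).bij⟩
end

section
/- Let R be a Noetherian unique factorization domain and let M be a finitely generated torsion-free R-module of rank 1 (i.e., M ⊗[R] Frac(R) is one-dimensional over Frac(R)). Then the double dual M** = Hom_R(Hom_R(M, R), R) is a free R-module of rank 1. -/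
open TensorProduct

theorem UniqueFactorizationMonoid.exists_forall_dvd_and_forall_dvd_mul
    {R : Type*} [CommRing R] [IsDomain R] [UniqueFactorizationMonoid R] (s : Finset R) :
    ∃ g : R, (∀ a ∈ s, g ∣ a) ∧ ∀ d c : R, (∀ a ∈ s, d ∣ a * c) → d ∣ g * c := by
  classical
  let : StrongNormalizationMonoid R := UniqueFactorizationMonoid.strongNormalizationMonoid
  let : StrongNormalizedGCDMonoid R := UniqueFactorizationMonoid.toStrongNormalizedGCDMonoid R
  refine ⟨s.gcd id, fun a ha => Finset.gcd_dvd ha, fun d c h => ?_⟩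
  have h' : d ∣ s.gcd fun a => id a * c := Finset.dvd_gcd h
  rw [Finset.gcd_mul_right] at h'
  exact h'.trans (mul_dvd_mul_left _ (normalize_associated c).dvd)

/-- A nonzero finitely generated module that embeds in a unique factorization domain has a dual
that is free of rank 1. -/
theorem Module.Dual.nonempty_linearEquiv_of_injective
    {R : Type*} [CommRing R] [IsDomain R] [UniqueFactorizationMonoid R]
    {M : Type*} [AddCommGroup M] [Module R M] [Module.Finite R M] [Nontrivial M]
    (f : M →ₗ[R] R) (hf : Function.Injective f) :
    Nonempty (R ≃ₗ[R] Module.Dual R M) := by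
  classical
  obtain ⟨s, hs⟩ := Module.Finite.fg_top (R := R) (M := M)
  obtain ⟨g, hg, hgc⟩ :=
    UniqueFactorizationMonoid.exists_forall_dvd_and_forall_dvd_mul (s.image f)
  have hdvd : ∀ x, g ∣ f x := by
    intro x
    have hx : x ∈ Submodule.span R (s : Set M) := hs ▸ Submodule.mem_top
    induction hx using Submodule.span_induction with
    | mem x hx => exact hg _ (Finset.mem_image_of_mem f hx)
    | zero => simp
    | add x y _ _ hx hy => rw [map_add]; exact dvd_add hx hy
    | smul r x _ hx => rw [map_smul]; exact hx.mul_left r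
  obtain ⟨m, hm⟩ := exists_ne (0 : M)
  have hfm : f m ≠ 0 := (map_ne_zero_iff f hf).2 hm
  have hg0 : g ≠ 0 := ne_zero_of_dvd_ne_zero hfm (hdvd m)
  choose q hq using hdvd
  let p : Module.Dual R M :=
    { toFun := q
      map_add' := fun x y => mul_left_cancel₀ hg0 (by rw [mul_add, ← hq, ← hq, ← hq, map_add])
      map_smul' := fun r x => mul_left_cancel₀ hg0 (by
        rw [RingHom.id_apply, smul_eq_mul, mul_left_comm, ← hq, ← hq, map_smul, smul_eq_mul]) }
  have hqm : q m ≠ 0 := fun h => hfm (by rw [hq, h, mul_zero])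
  refine ⟨LinearEquiv.ofBijective (LinearMap.toSpanSingleton R (Module.Dual R M) p) ⟨?_, ?_⟩⟩
  · intro a b hab
    exact mul_right_cancel₀ hqm (LinearMap.congr_fun hab m)
  · intro ψ
    have hψ : ∀ x, f m * ψ x = f x * ψ m := by
      intro x
      have h : f m • x = f x • m := hf (by simp [mul_comm])
      simpa using congrArg ψ h
    have hmψ : g * q m ∣ g * ψ m := by
      rw [← hq]
      refine hgc _ _ fun a ha => ?_
      obtain ⟨x, -, rfl⟩ := Finset.mem_image.1 ha
      exact ⟨ψ x, (hψ x).symm⟩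
    obtain ⟨r, hr⟩ := (mul_dvd_mul_iff_left hg0).1 hmψ
    refine ⟨r, LinearMap.ext fun x => mul_left_cancel₀ hfm ?_⟩
    change f m * (r * q x) = f m * ψ x
    rw [hψ, hr, hq m, hq x]
    ring

/-- A finitely generated torsion-free module of rank 1 over a domain embeds in the domain. -/
theorem Module.exists_injective_linearMap_of_rank_eq_one
    {R : Type*} [CommRing R] [IsDomain R]
    {M : Type*} [AddCommGroup M] [Module R M] [Module.Finite R M] [NoZeroSMulDivisors R M]
    (hrank : Module.rank (FractionRing R) ((FractionRing R) ⊗[R] M) = 1) :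
    ∃ f : M →ₗ[R] R, Function.Injective f := by
  have hfin : Module.finrank (FractionRing R) (FractionRing R ⊗[R] M) =
      Module.finrank (FractionRing R) (FractionRing R) := by
    rw [Module.finrank_self, Module.finrank, hrank, Cardinal.one_toNat]
  let e : FractionRing R ⊗[R] M ≃ₗ[FractionRing R] FractionRing R :=
    LinearEquiv.ofFinrankEq _ _ hfin
  let φ : M →ₗ[R] FractionRing R :=
    (e.restrictScalars R).toLinearMap ∘ₗ TensorProduct.mk R (FractionRing R) M 1
  have hφ : Function.Injective φ := by
    refine e.injective.comp ((injective_iff_map_eq_zero _).2 fun x hx => ?_)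
    obtain ⟨c, hc⟩ := (IsLocalizedModule.eq_zero_iff (nonZeroDivisors R)
      (TensorProduct.mk R (FractionRing R) M 1)).1 hx
    exact (smul_eq_zero.1 hc).resolve_left (nonZeroDivisors.ne_zero c.2)
  obtain ⟨a, ha, hint⟩ := FractionalIdeal.isFractional_of_fg (S := nonZeroDivisors R)
    (I := LinearMap.range φ) (LinearMap.range_eq_map φ ▸ Module.Finite.fg_top.map φ)
  have ha0 : a ≠ 0 := nonZeroDivisors.ne_zero ha
  have hinj : Function.Injective (Algebra.linearMap R (FractionRing R)) :=
    IsFractionRing.injective R (FractionRing R)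
  let ι := LinearEquiv.ofInjective (Algebra.linearMap R (FractionRing R)) hinj
  let ψ := (a • φ).codRestrict (LinearMap.range (Algebra.linearMap R (FractionRing R)))
    fun x => hint (φ x) ⟨x, rfl⟩
  refine ⟨ι.symm.toLinearMap ∘ₗ ψ, ι.symm.injective.comp fun x y hxy => hφ ?_⟩
  exact smul_right_injective _ ha0 (congrArg Subtype.val hxy)



/-- Over a Noetherian UFD, the double dual of a finitely generated torsion-free
module of rank 1 is free of rank 1. -/
theorem double_dual_of_rank_one_free
    (R : Type*) [CommRing R] [IsDomain R] [IsNoetherianRing R]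
    [UniqueFactorizationMonoid R]
    (M : Type*) [AddCommGroup M] [Module R M] [Module.Finite R M]
    [NoZeroSMulDivisors R M]
    (hrank : Module.rank (FractionRing R) ((FractionRing R) ⊗[R] M) = 1) :
    Nonempty ((Module.Dual R (Module.Dual R M)) ≃ₗ[R] R) := by
  have : Nontrivial M := by
    by_contra h
    rw [not_nontrivial_iff_subsingleton] at h
    have : Subsingleton (FractionRing R ⊗[R] M) := inferInstance
    rw [rank_subsingleton'] at hrank
    exact zero_ne_one hrank
  obtain ⟨f, hf⟩ := Module.exists_injective_linearMap_of_rank_eq_one hrank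
  obtain ⟨e⟩ := Module.Dual.nonempty_linearEquiv_of_injective f hf
  exact ⟨e.dualMap.trans (LinearMap.ringLmapEquivSelf R R R)⟩
end
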